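/- For every n ≥ 2: if f_n < 3·p_n, then there exists a twin prime pair inside the interval [p_n, 3·p_n + 4], i.e. there is a prime q with q + 2 also prime, p_n ≤ q, and q + 2 ≤ 3·p_n + 4. -/

import Mathlib

open Filter Pointwise

/-- `nthPrime n` is the `n`-th prime number (1-indexed): `nthPrime 1 = 2`, etc. -/
noncomputable def nthPrime (n : ℕ) : ℕ := Nat.nth Nat.Prime (n - 1)

/-- `S n` is the additive submonoid of `ℕ` generated by the primes `q ≥ nthPrime n`. -/
def S (n : ℕ) : AddSubmonoid ℕ :=
  AddSubmonoid.closure {q : ℕ | q.Prime ∧ nthPrime n ≤ q}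

/-- `frob n` is the Frobenius number of `S n`: the largest natural number not in `S n`. -/
noncomputable def frob (n : ℕ) : ℕ := sSup {m : ℕ | m ∉ S n}

/-- `genus n` is the number of natural numbers not in `S n`. -/
noncomputable def genus (n : ℕ) : ℕ := {m : ℕ | m ∉ S n}.ncard

/-- `atoms n` is the minimal generating set `S n \ {0} \ ((S n \ {0}) + (S n \ {0}))`. -/
def atoms (n : ℕ) : Set ℕ :=
  ((S n : Set ℕ) \ {0}) \ (((S n : Set ℕ) \ {0}) + ((S n : Set ℕ) \ {0}))

/-- `u n` is the largest atom of `S n`. -/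
noncomputable def u (n : ℕ) : ℕ := sSup (atoms n)

/-- `e n` is the embedding dimension of `S n`: the number of atoms. -/
noncomputable def e (n : ℕ) : ℕ := (atoms n).ncard

theorem bddAbove_compl_S (n : ℕ) : BddAbove {m : ℕ | m ∉ S n} := by
  obtain ⟨p, hp, hpp⟩ := Nat.exists_infinite_primes (nthPrime n)
  obtain ⟨q, hq, hqp⟩ := Nat.exists_infinite_primes (p + 1)
  have hcop : p.Coprime q := (Nat.coprime_primes hpp hqp).2 (by omega)
  refine ⟨_, fun m hm => (frobeniusNumber_pair hcop hpp.one_lt hqp.one_lt).2 fun hmem => hm ?_⟩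
  refine AddSubmonoid.closure_mono ?_ hmem
  rintro x (rfl | rfl)
  · exact ⟨hpp, hp⟩
  · exact ⟨hqp, by omega⟩

theorem mem_S_of_frob_lt {n m : ℕ} (h : frob n < m) : m ∈ S n := by
  by_contra hm
  exact absurd (le_csSup (bddAbove_compl_S n) hm) (not_le.2 h)

theorem nthPrime_prime (n : ℕ) : (nthPrime n).Prime :=
  Nat.prime_nth_prime _

theorem three_le_nthPrime {n : ℕ} (hn : 2 ≤ n) : 3 ≤ nthPrime n := by
  rw [← Nat.nth_prime_one_eq_three]
  exact Nat.nth_monotone Nat.infinite_setOfPred_prime (by omega)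

/-- An element of `S n` is a sum of at most three generators, or it is at least
`4 * nthPrime n` and even, or it is at least `5 * nthPrime n`. -/
theorem eq_sum_of_mem_S {n m : ℕ} (hn : 2 ≤ n) (hm : m ∈ S n) :
    m = 0 ∨ (m.Prime ∧ nthPrime n ≤ m) ∨
    (∃ a b : ℕ, (a.Prime ∧ nthPrime n ≤ a) ∧ (b.Prime ∧ nthPrime n ≤ b) ∧ m = a + b) ∨
    (∃ a b c : ℕ, (a.Prime ∧ nthPrime n ≤ a) ∧ (b.Prime ∧ nthPrime n ≤ b) ∧
      (c.Prime ∧ nthPrime n ≤ c) ∧ m = a + b + c) ∨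
    (4 * nthPrime n ≤ m ∧ Even m) ∨ 5 * nthPrime n ≤ m := by
  have h3 := three_le_nthPrime hn
  have hodd : ∀ a : ℕ, a.Prime ∧ nthPrime n ≤ a → a % 2 = 1 := fun a ha =>
    Nat.odd_iff.1 (ha.1.odd_of_ne_two (by omega))
  induction hm using AddSubmonoid.closure_induction_left with
  | zero => exact Or.inl rfl
  | add_left x hx y _ ih =>
    have hx1 := hodd x hx
    have hx2 := hx.2
    rcases ih with rfl | hy | ⟨a, b, ha, hb, rfl⟩ | ⟨a, b, c, ha, hb, hc, rfl⟩ | ⟨h4, -⟩ | h5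
    · exact Or.inr (Or.inl hx)
    · exact Or.inr (Or.inr (Or.inl ⟨x, y, hx, hy, rfl⟩))
    · exact Or.inr (Or.inr (Or.inr (Or.inl ⟨x, a, b, hx, ha, hb, by ring⟩)))
    · have := hodd a ha
      have := hodd b hb
      have := hodd c hc
      refine Or.inr (Or.inr (Or.inr (Or.inr (Or.inl ⟨by omega, ?_⟩))))
      rw [Nat.even_iff]
      omega
    · exact Or.inr (Or.inr (Or.inr (Or.inr (Or.inr (by omega)))))
    · exact Or.inr (Or.inr (Or.inr (Or.inr (Or.inr (by omega)))))

theorem prime_or_eq_sum_three_of_mem_S {n m : ℕ} (hn : 2 ≤ n) (hm : m ∈ S n) (hodd : Odd m)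
    (hlt : m < 5 * nthPrime n) :
    m.Prime ∨ ∃ i j k : ℕ, (nthPrime n + i).Prime ∧ (nthPrime n + j).Prime ∧
      (nthPrime n + k).Prime ∧ i % 2 = 0 ∧ j % 2 = 0 ∧ k % 2 = 0 ∧
      m = 3 * nthPrime n + (i + j + k) := by
  have h3 := three_le_nthPrime hn
  have hodd' : ∀ a : ℕ, a.Prime ∧ nthPrime n ≤ a → a % 2 = 1 := fun a ha =>
    Nat.odd_iff.1 (ha.1.odd_of_ne_two (by omega))
  have hp := hodd' _ ⟨nthPrime_prime n, le_rfl⟩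
  rw [Nat.odd_iff] at hodd
  rcases eq_sum_of_mem_S hn hm with
    rfl | h | ⟨a, b, ha, hb, rfl⟩ | ⟨a, b, c, ha, hb, hc, rfl⟩ | ⟨-, h⟩ | h
  · omega
  · exact Or.inl h.1
  · have := hodd' a ha
    have := hodd' b hb
    omega
  · have := hodd' a ha
    have := hodd' b hb
    have := hodd' c hc
    obtain ⟨ha, i, rfl⟩ := ha.imp_right Nat.exists_eq_add_of_le
    obtain ⟨hb, j, rfl⟩ := hb.imp_right Nat.exists_eq_add_of_le
    obtain ⟨hc, k, rfl⟩ := hc.imp_right Nat.exists_eq_add_of_le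
    exact Or.inr ⟨i, j, k, ha, hb, hc, by omega, by omega, by omega, by omega⟩
  · rw [Nat.even_iff] at h
    omega
  · omega

theorem twin_primes_of_frob_lt (n : ℕ) (hn : 2 ≤ n) (h : frob n < 3 * nthPrime n) :
    ∃ q : ℕ, q.Prime ∧ (q + 2).Prime ∧ nthPrime n ≤ q ∧ q + 2 ≤ 3 * nthPrime n + 4 := by
  have h3 := three_le_nthPrime hn
  have hp := nthPrime_prime n
  have hodd : nthPrime n % 2 = 1 := Nat.odd_iff.1 (hp.odd_of_ne_two (by omega))
  have key : ∀ d : ℕ, d ≤ 6 → d % 2 = 0 → 3 < nthPrime n → (3 * nthPrime n + d).Prime ∨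
      ∃ i j k : ℕ, (nthPrime n + i).Prime ∧ (nthPrime n + j).Prime ∧ (nthPrime n + k).Prime ∧
        i % 2 = 0 ∧ j % 2 = 0 ∧ k % 2 = 0 ∧ i + j + k = d := by
    intro d hd hd2 h4
    refine (prime_or_eq_sum_three_of_mem_S (m := 3 * nthPrime n + d) hn
      (mem_S_of_frob_lt (by omega)) (Nat.odd_iff.2 (by omega)) (by omega)).imp_right ?_
    rintro ⟨i, j, k, hi, hj, hk, hi2, hj2, hk2, hijk⟩
    exact ⟨i, j, k, hi, hj, hk, hi2, hj2, hk2, by omega⟩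
  generalize nthPrime n = p at *
  rcases h3.eq_or_lt with rfl | h4
  · exact ⟨3, by norm_num⟩
  by_cases hp2 : (p + 2).Prime
  · exact ⟨p, hp, hp2, le_rfl, by omega⟩
  have ne_two : ∀ i, (p + i).Prime → i ≠ 2 := by
    rintro i hi rfl
    exact hp2 hi
  have h2 : (3 * p + 2).Prime := by
    refine (key 2 (by norm_num) rfl h4).resolve_right ?_
    rintro ⟨i, j, k, hi, hj, hk, hi2, hj2, hk2, hijk⟩
    have := ne_two i hi
    have := ne_two j hj
    have := ne_two k hk
    omega
  rcases key 4 (by norm_num) rfl h4 with h34 | ⟨i, j, k, hi, hj, hk, hi2, hj2, hk2, hijk⟩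
  · exact ⟨3 * p + 2, h2, h34, by omega, by omega⟩
  have hp4 : (p + 4).Prime := by
    have := ne_two i hi
    have := ne_two j hj
    have := ne_two k hk
    obtain rfl | rfl | rfl : i = 4 ∨ j = 4 ∨ k = 4 := by omega
    all_goals assumption
  have h36 : ¬ (3 * p + 6).Prime := by
    rw [show 3 * p + 6 = 3 * (p + 2) by ring]
    exact Nat.not_prime_mul (by norm_num) (by omega)
  obtain ⟨i, j, k, hi, hj, hk, hi2, hj2, hk2, hijk⟩ := (key 6 le_rfl rfl h4).resolve_left h36
  have hp6 : (p + 6).Prime := by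
    have := ne_two i hi
    have := ne_two j hj
    have := ne_two k hk
    obtain rfl | rfl | rfl : i = 6 ∨ j = 6 ∨ k = 6 := by omega
    all_goals assumption
  exact ⟨p + 4, hp4, hp6, by omega, by omega⟩
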